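/- Let $\lambda \in \mathbb{R}$ with $\lambda < 1$ and $\lambda \neq 0$. Suppose $\xi : (0,\infty) \to \mathbb{R}$ is twice continuously differentiable, satisfies $\xi''(z) + 2\coth(2z)\,\xi'(z) + \lambda\,\xi(z) = 0$ for all $z > 0$, satisfies the Robin boundary condition $\lim_{z \to 0^+}\big(\sinh(2z)\,\log(\tanh z)\,\xi'(z) - 2\,\xi(z)\big) = 0$, and satisfies $\int_0^\infty \sinh(2z)\,\xi(z)^2\,dz < \infty$. Then $\xi$ is identically zero. -/

import Mathlib

open Set Real MeasureTheory Filter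

/-- `ξ cosh z`. -/
noncomputable def ssV (ξ : ℝ → ℝ) (z : ℝ) : ℝ := ξ z * Real.cosh z

/-- Derivative of `ξ cosh z`. -/
noncomputable def ssD (ξ : ℝ → ℝ) (z : ℝ) : ℝ := deriv ξ z * Real.cosh z + ξ z * Real.sinh z

/-- The weight. -/
noncomputable def ssw (z : ℝ) : ℝ := 2 * Real.sinh z / Real.cosh z

/-- The flux. -/
noncomputable def ssM (ξ : ℝ → ℝ) (z : ℝ) : ℝ := ssw z * ssD ξ z

/-- The potential. -/
noncomputable def ssq (lam z : ℝ) : ℝ := 1 - lam + 1 / Real.cosh z ^ 2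

lemma ssw_pos {z : ℝ} (hz : 0 < z) : 0 < ssw z :=
  div_pos (mul_pos two_pos (Real.sinh_pos_iff.2 hz)) (Real.cosh_pos z)

lemma ssw_le {z : ℝ} : ssw z ≤ 2 := by
  unfold ssw
  rw [div_le_iff₀ (Real.cosh_pos z)]
  linarith [Real.sinh_lt_cosh z]

lemma ssw_hasDeriv (z : ℝ) : HasDerivAt ssw (2 / Real.cosh z ^ 2) z := by
  have h := ((Real.hasDerivAt_sinh z).const_mul 2).div (Real.hasDerivAt_cosh z)
    (Real.cosh_pos z).ne'
  refine h.congr_deriv ?_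
  congr 1
  have := Real.cosh_sq z
  linear_combination 2 * this

lemma ssw_mono {a b : ℝ} (h : a ≤ b) : ssw a ≤ ssw b := by
  have : Monotone ssw := monotone_of_hasDerivAt_nonneg ssw_hasDeriv
    (fun z => by have := Real.cosh_pos z; simp only [Pi.zero_apply]; positivity)
  exact this h

lemma ssq_pos {lam : ℝ} (h : lam < 1) (z : ℝ) : 0 < ssq lam z := by
  have := Real.cosh_pos z
  have h2 : 0 < 1 / Real.cosh z ^ 2 := by positivity
  unfold ssq; linarith

lemma ssq_le (lam z : ℝ) : ssq lam z ≤ 2 - lam := by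
  have := Real.one_le_cosh z
  have h2 : 1 / Real.cosh z ^ 2 ≤ 1 := by
    rw [div_le_one (by positivity)]; nlinarith
  unfold ssq; linarith

/-- monotonicity on `[a, b]` from a nonnegative derivative on `(0,∞)`. -/
lemma ss_mono {f f' : ℝ → ℝ} {a : ℝ} (ha : 0 < a)
    (hf : ∀ z, 0 < z → HasDerivAt f (f' z) z)
    (hn : ∀ z, a ≤ z → 0 ≤ f' z) : MonotoneOn f (Ici a) := by
  apply monotoneOn_of_hasDerivWithinAt_nonneg (convex_Ici a) (f' := f')
  · intro z hz
    exact (hf z (lt_of_lt_of_le ha hz)).continuousAt.continuousWithinAt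
  · intro z hz
    rw [interior_Ici] at hz
    exact (hf z (lt_trans ha hz)).hasDerivWithinAt
  · intro z hz
    rw [interior_Ici] at hz
    exact hn z (le_of_lt hz)

lemma ss_not_strictMono {f : ℝ → ℝ} (h : StrictMonoOn f (Ioi 0))
    (h0 : Tendsto f (nhdsWithin 0 (Ioi 0)) (nhds 0)) (h1 : Tendsto f atTop (nhds 0)) : False := by
  have a1 : 0 ≤ f 1 := by
    refine le_of_tendsto h0 ?_
    filter_upwards [Ioo_mem_nhdsGT (zero_lt_one (α := ℝ))] with z hz
    exact (h hz.1 (by simp : (1:ℝ) ∈ Ioi 0) hz.2).le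
  have a2 : f 2 ≤ 0 := by
    refine ge_of_tendsto h1 ?_
    filter_upwards [eventually_gt_atTop 2] with z hz
    exact (h (by simp) (by simp; linarith) hz).le
  have := h (by simp : (1:ℝ) ∈ Ioi 0) (by simp : (2:ℝ) ∈ Ioi 0) (by norm_num)
  linarith

lemma ss_log_bound {z : ℝ} (hz : 0 < z) :
    |Real.sinh (2*z) * Real.log (Real.tanh z)| ≤ 2 := by
  have hs := Real.sinh_pos_iff.2 hz
  have hc := Real.cosh_pos z
  have hsc := Real.sinh_lt_cosh z
  have ht : 0 < Real.tanh z := by rw [Real.tanh_eq_sinh_div_cosh]; positivity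
  have ht1 : Real.tanh z < 1 := Real.tanh_lt_one z
  have hl : Real.log (Real.tanh z) < 0 := Real.log_neg ht ht1
  have h2 := Real.one_sub_inv_le_log_of_pos ht
  have e : (Real.tanh z)⁻¹ = Real.cosh z / Real.sinh z := by
    rw [Real.tanh_eq_sinh_div_cosh, inv_div]
  rw [e] at h2
  have h3 : 2 * Real.sinh z * Real.cosh z * (1 - Real.cosh z / Real.sinh z)
      = 2 * (Real.sinh z * Real.cosh z - Real.cosh z ^ 2) := by
    field_simp
  have h4 := mul_le_mul_of_nonneg_left h2 (by positivity : 0 ≤ 2 * Real.sinh z * Real.cosh z)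
  rw [h3] at h4
  have h5 := Real.cosh_sq z
  rw [Real.sinh_two_mul, abs_le]
  constructor
  · nlinarith
  · nlinarith [mul_pos hs hc]

section
variable {lam : ℝ} {ξ : ℝ → ℝ}

lemma ss_d1 (hξ : ContDiffOn ℝ 2 ξ (Ioi 0)) {z : ℝ} (hz : 0 < z) :
    HasDerivAt ξ (deriv ξ z) z :=
  ((hξ.differentiableOn (by norm_num)).differentiableAt (Ioi_mem_nhds hz)).hasDerivAt

lemma ss_d2 (hξ : ContDiffOn ℝ 2 ξ (Ioi 0)) {z : ℝ} (hz : 0 < z) :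
    HasDerivAt (deriv ξ) (deriv (deriv ξ) z) z := by
  have h : ContDiffOn ℝ 1 (deriv ξ) (Ioi 0) :=
    hξ.deriv_of_isOpen isOpen_Ioi (by norm_num)
  exact ((h.differentiableOn (by norm_num)).differentiableAt (Ioi_mem_nhds hz)).hasDerivAt

lemma ss_dV (hξ : ContDiffOn ℝ 2 ξ (Ioi 0)) {z : ℝ} (hz : 0 < z) :
    HasDerivAt (ssV ξ) (ssD ξ z) z :=
  (ss_d1 hξ hz).mul (Real.hasDerivAt_cosh z)

lemma ss_dM (hξ : ContDiffOn ℝ 2 ξ (Ioi 0))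
    (hode : ∀ z > (0:ℝ),
      deriv (deriv ξ) z + 2 * (Real.cosh (2*z) / Real.sinh (2*z)) * deriv ξ z
        + lam * ξ z = 0) {z : ℝ} (hz : 0 < z) :
    HasDerivAt (ssM ξ) (ssw z * ssq lam z * ssV ξ z) z := by
  have h := (ssw_hasDeriv z).mul (((ss_d2 hξ hz).mul (Real.hasDerivAt_cosh z)).add
    ((ss_d1 hξ hz).mul (Real.hasDerivAt_sinh z)))
  refine h.congr_deriv ?_
  have o := hode z hz
  have hs := Real.sinh_pos_iff.2 hz
  have hc := Real.cosh_pos z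
  have h5 := Real.cosh_sq z
  rw [Real.sinh_two_mul, Real.cosh_two_mul] at o
  have o' : deriv (deriv ξ) z = - (2 * ((Real.cosh z ^ 2 + Real.sinh z ^ 2) /
    (2 * Real.sinh z * Real.cosh z)) * deriv ξ z) - lam * ξ z := by linarith
  simp only [Pi.add_apply, Pi.mul_apply]
  rw [o']
  unfold ssw ssq ssV
  field_simp
  have h6 : Real.sinh z ^ 2 = Real.cosh z ^ 2 - 1 := by linarith
  grind

lemma ss_dVM (hξ : ContDiffOn ℝ 2 ξ (Ioi 0))
    (hode : ∀ z > (0:ℝ),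
      deriv (deriv ξ) z + 2 * (Real.cosh (2*z) / Real.sinh (2*z)) * deriv ξ z
        + lam * ξ z = 0) {z : ℝ} (hz : 0 < z) :
    HasDerivAt (fun z => ssV ξ z * ssM ξ z)
      (ssw z * (ssD ξ z ^ 2 + ssq lam z * ssV ξ z ^ 2)) z := by
  refine ((ss_dV hξ hz).mul (ss_dM hξ hode hz)).congr_deriv ?_
  unfold ssM
  ring

lemma ss_dVV (hξ : ContDiffOn ℝ 2 ξ (Ioi 0)) {z : ℝ} (hz : 0 < z) :
    HasDerivAt (fun z => ssV ξ z ^ 2) (2 / ssw z * (ssV ξ z * ssM ξ z)) z := by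
  have hw := ssw_pos hz
  refine ((ss_dV hξ hz).pow 2).congr_deriv ?_
  unfold ssM
  field_simp
  push_cast
  ring

lemma ss_dMM (hξ : ContDiffOn ℝ 2 ξ (Ioi 0))
    (hode : ∀ z > (0:ℝ),
      deriv (deriv ξ) z + 2 * (Real.cosh (2*z) / Real.sinh (2*z)) * deriv ξ z
        + lam * ξ z = 0) {z : ℝ} (hz : 0 < z) :
    HasDerivAt (fun z => ssM ξ z ^ 2)
      (2 * ssw z * ssq lam z * (ssV ξ z * ssM ξ z)) z := by
  refine ((ss_dM hξ hode hz).pow 2).congr_deriv ?_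
  push_cast
  ring

/-- Vanishing of the Cauchy data propagates to the left. -/
lemma ss_back (hlam1 : lam < 1) (hξ : ContDiffOn ℝ 2 ξ (Ioi 0))
    (hode : ∀ z > (0:ℝ),
      deriv (deriv ξ) z + 2 * (Real.cosh (2*z) / Real.sinh (2*z)) * deriv ξ z
        + lam * ξ z = 0) {a b : ℝ} (ha : 0 < a) (hab : a ≤ b)
    (hV : ssV ξ b = 0) (hM : ssM ξ b = 0) : ssV ξ a = 0 := by
  set K := 1 / ssw a + 2 * (2 - lam) with hK
  have hd : ∀ z, 0 < z → HasDerivAt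
      (fun z => (ssV ξ z ^ 2 + ssM ξ z ^ 2) * Real.exp (K * z))
      ((2 / ssw z * (ssV ξ z * ssM ξ z) + 2 * ssw z * ssq lam z * (ssV ξ z * ssM ξ z)
        + K * (ssV ξ z ^ 2 + ssM ξ z ^ 2)) * Real.exp (K * z)) z := by
    intro z hz
    have h1 := (ss_dVV hξ hz).add (ss_dMM hξ hode hz)
    have h2 : HasDerivAt (fun z => Real.exp (K * z)) (Real.exp (K * z) * (K * 1)) z :=
      ((hasDerivAt_id z).const_mul K).exp
    refine (h1.mul h2).congr_deriv ?_
    simp only [Pi.add_apply]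
    ring
  have hm := ss_mono ha hd (by
    intro z hz
    have hwa := ssw_pos ha
    have hw := ssw_pos (lt_of_lt_of_le ha hz)
    have hq := ssq_pos hlam1 z
    have h1 : 1 / ssw z ≤ 1 / ssw a := one_div_le_one_div_of_le hwa (ssw_mono hz)
    have h2 : ssw z * ssq lam z ≤ 2 * (2 - lam) :=
      mul_le_mul ssw_le (ssq_le lam z) hq.le (by norm_num)
    have h3 : 0 < 1 / ssw z + ssw z * ssq lam z := by positivity
    refine mul_nonneg ?_ (Real.exp_pos _).le
    have h4 : 2 / ssw z * (ssV ξ z * ssM ξ z) + 2 * ssw z * ssq lam z * (ssV ξ z * ssM ξ z)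
        + K * (ssV ξ z ^ 2 + ssM ξ z ^ 2) =
        (1 / ssw z + ssw z * ssq lam z) * (ssV ξ z + ssM ξ z) ^ 2 +
        (K - (1 / ssw z + ssw z * ssq lam z)) * (ssV ξ z ^ 2 + ssM ξ z ^ 2) := by ring
    rw [h4]
    have h5 : 0 ≤ K - (1 / ssw z + ssw z * ssq lam z) := by linarith
    positivity)
  have := hm (self_mem_Ici) hab hab
  simp only [hV, hM] at this
  have he := Real.exp_pos (K * a)
  have h6 : ssV ξ a ^ 2 + ssM ξ a ^ 2 ≤ 0 := by
    by_contra hcon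
    push Not at hcon
    have := mul_pos hcon he
    norm_num at *
    linarith
  nlinarith [sq_nonneg (ssV ξ a), sq_nonneg (ssM ξ a)]

lemma ss_nonneg_imp (hlam1 : lam < 1) (hξ : ContDiffOn ℝ 2 ξ (Ioi 0))
    (hode : ∀ z > (0:ℝ),
      deriv (deriv ξ) z + 2 * (Real.cosh (2*z) / Real.sinh (2*z)) * deriv ξ z
        + lam * ξ z = 0)
    (hint : IntegrableOn (fun z => Real.sinh (2*z) * ξ z ^ 2) (Ioi 0))
    {a : ℝ} (ha : 0 < a) (h : 0 ≤ ssV ξ a * ssM ξ a) : ∀ z, a ≤ z → ssV ξ z = 0 := by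
  have hm : ∀ z, a ≤ z → 0 ≤ ssV ξ z * ssM ξ z := by
    intro z hz
    refine h.trans (ss_mono ha (fun z hz => ss_dVM hξ hode hz) ?_ self_mem_Ici hz hz)
    intro z hz
    have hw := ssw_pos (lt_of_lt_of_le ha hz)
    have hq := ssq_pos hlam1 z
    positivity
  have hv : MonotoneOn (fun z => ssV ξ z ^ 2) (Ici a) := by
    refine ss_mono ha (fun z hz => ss_dVV hξ hz) ?_
    intro z hz
    have hw := ssw_pos (lt_of_lt_of_le ha hz)
    exact mul_nonneg (by positivity) (hm z hz)
  intro b hb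
  by_contra hne
  have hb0 : 0 < b := lt_of_lt_of_le ha hb
  have hwb := ssw_pos hb0
  set C := ssw b * ssV ξ b ^ 2 with hC
  have hCpos : 0 < C := by positivity
  have hI : IntegrableOn (fun _ : ℝ => C) (Ioi b) := by
    refine Integrable.mono' (hint.mono_set (Ioi_subset_Ioi hb0.le))
      aestronglyMeasurable_const ?_
    refine (ae_restrict_iff' measurableSet_Ioi).2 (Eventually.of_forall ?_)
    intro z hz
    have hz' : b < z := hz
    rw [Real.norm_of_nonneg hCpos.le]
    have e : Real.sinh (2*z) * ξ z ^ 2 = ssw z * ssV ξ z ^ 2 := by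
      have hc := Real.cosh_pos z
      rw [Real.sinh_two_mul]; unfold ssw ssV; field_simp
    rw [e]
    exact mul_le_mul (ssw_mono hz'.le) (hv hb (hb.trans hz'.le) hz'.le) (sq_nonneg _)
      (ssw_pos (hb0.trans hz')).le
  rw [integrableOn_const_iff] at hI
  simp [hCpos.ne'] at hI

lemma ss_dW (hξ : ContDiffOn ℝ 2 ξ (Ioi 0))
    (hode : ∀ z > (0:ℝ),
      deriv (deriv ξ) z + 2 * (Real.cosh (2*z) / Real.sinh (2*z)) * deriv ξ z
        + lam * ξ z = 0) {z : ℝ} (hz : 0 < z) :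
    HasDerivAt (fun z => Real.sinh (2*z) * Real.log (Real.tanh z) * deriv ξ z - 2 * ξ z)
      (-lam * (Real.sinh (2*z) * Real.log (Real.tanh z) * ξ z)) z := by
  have hs := Real.sinh_pos_iff.2 hz
  have hc := Real.cosh_pos z
  have hs2 : 0 < Real.sinh (2*z) := Real.sinh_pos_iff.2 (by linarith)
  have h5 := Real.cosh_sq z
  have hT : HasDerivAt Real.tanh (1 / Real.cosh z ^ 2) z := by
    have h := (Real.hasDerivAt_sinh z).div (Real.hasDerivAt_cosh z) hc.ne'
    have e : Real.tanh = Real.sinh / Real.cosh := by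
      funext x; exact Real.tanh_eq_sinh_div_cosh x
    rw [e]
    refine h.congr_deriv ?_
    congr 1
    linear_combination h5
  have ht : 0 < Real.tanh z := by rw [Real.tanh_eq_sinh_div_cosh]; positivity
  have hS : HasDerivAt (fun z => Real.sinh (2*z)) (Real.cosh (2*z) * (2 * 1)) z :=
    ((hasDerivAt_id z).const_mul 2).sinh
  have h := ((hS.mul (hT.log ht.ne')).mul (ss_d2 hξ hz)).sub ((ss_d1 hξ hz).const_mul 2)
  refine h.congr_deriv ?_
  have o := hode z hz
  have o' : deriv (deriv ξ) z = - (2 * (Real.cosh (2*z) / Real.sinh (2*z)) * deriv ξ z)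
      - lam * ξ z := by linarith
  have e2 : Real.sinh (2*z) * (1 / Real.cosh z ^ 2 / Real.tanh z) = 2 := by
    rw [Real.sinh_two_mul, Real.tanh_eq_sinh_div_cosh]; field_simp
  simp only [Pi.mul_apply]
  rw [e2, o']
  field_simp
  ring

end

/-- No bound states below the essential spectrum other than the zero mode for the
Salam-Sezgin Sturm-Liouville problem: if `λ < 1`, `λ ≠ 0`, and a C² function
satisfies `ξ'' + 2 coth(2z) ξ' + λ ξ = 0` on `(0,∞)`, the Robin boundary condition
`lim_{z→0⁺} (sinh(2z) log(tanh z) ξ'(z) - 2 ξ(z)) = 0`, and is square-integrable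
with respect to `sinh(2z) dz`, then `ξ ≡ 0`. -/
theorem salamSezgin_no_other_bound_states
    (lam : ℝ) (hlam1 : lam < 1) (hlam0 : lam ≠ 0) (ξ : ℝ → ℝ)
    (hξ : ContDiffOn ℝ 2 ξ (Ioi 0))
    (hode : ∀ z > (0:ℝ),
      deriv (deriv ξ) z + 2 * (Real.cosh (2*z) / Real.sinh (2*z)) * deriv ξ z
        + lam * ξ z = 0)
    (hrobin : Tendsto
      (fun z => Real.sinh (2*z) * Real.log (Real.tanh z) * deriv ξ z - 2 * ξ z)
      (nhdsWithin 0 (Ioi 0)) (nhds 0))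
    (hint : IntegrableOn (fun z => Real.sinh (2*z) * ξ z ^ 2) (Ioi 0)) :
    ∀ z > (0:ℝ), ξ z = 0 := by
  by_contra hcon
  push Not at hcon
  obtain ⟨z₀, hz₀, hne⟩ := hcon
  have hneV : ssV ξ z₀ ≠ 0 := mul_ne_zero hne (Real.cosh_pos _).ne'
  -- the product of `v` and its flux is negative everywhere
  have hneg : ∀ a, 0 < a → ssV ξ a * ssM ξ a < 0 := by
    intro a ha
    by_contra hc
    push Not at hc
    have hz := ss_nonneg_imp hlam1 hξ hode hint ha hc
    set b := max a z₀ + 1 with hb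
    have hab : a < b := by have := le_max_left a z₀; linarith
    have hzb : z₀ ≤ b := by have := le_max_right a z₀; linarith
    have hD : ssD ξ b = 0 := by
      have h1 := ss_dV hξ (ha.trans hab)
      have h2 : HasDerivAt (ssV ξ) 0 b := by
        refine (hasDerivAt_const b (0:ℝ)).congr_of_eventuallyEq ?_
        filter_upwards [Ioi_mem_nhds hab] with x hx
        exact hz x (le_of_lt hx)
      exact h1.unique h2
    exact hneV (ss_back hlam1 hξ hode hz₀ hzb (hz b hab.le) (by simp [ssM, hD]))
  have hξne : ∀ a, 0 < a → ξ a ≠ 0 := by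
    intro a ha h
    have := hneg a ha
    simp [ssV, h] at this
  -- bounds at infinity
  have hVb : ∀ z, 1 ≤ z → |ssV ξ z| ≤ |ssV ξ 1| := by
    intro z hz
    have := ss_mono (f := fun z => -(ssV ξ z ^ 2)) one_pos (fun z hz => (ss_dVV hξ hz).neg) (by
      intro z hz
      have hz0 : 0 < z := by linarith
      have hw := ssw_pos hz0
      have h1 : 0 < 2 / ssw z := by positivity
      have := hneg z hz0
      nlinarith) self_mem_Ici hz hz
    simp only at this
    exact sq_le_sq.1 (by linarith)
  have hMb : ∀ z, 1 ≤ z → |ssM ξ z| ≤ |ssM ξ 1| := by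
    intro z hz
    have := ss_mono (f := fun z => -(ssM ξ z ^ 2)) one_pos
      (fun z hz => (ss_dMM hξ hode hz).neg) (by
      intro z hz
      have hz0 : 0 < z := by linarith
      have hw := ssw_pos hz0
      have hq := ssq_pos hlam1 z
      have h1 : 0 < 2 * ssw z * ssq lam z := by positivity
      have := hneg z hz0
      nlinarith) self_mem_Ici hz hz
    simp only at this
    exact sq_le_sq.1 (by linarith)
  have hw1 := ssw_pos one_pos
  set A := |ssV ξ 1| with hA
  set B := |ssM ξ 1| / ssw 1 with hB
  have hcosh : Tendsto Real.cosh atTop atTop := by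
    refine tendsto_atTop_mono (fun z => (Real.sinh_lt_cosh z).le) ?_
    refine tendsto_atTop_mono' atTop ?_ tendsto_id
    filter_upwards [eventually_ge_atTop 0] with z hz
    exact Real.self_le_sinh_iff.2 hz
  have hWinf : Tendsto
      (fun z => Real.sinh (2*z) * Real.log (Real.tanh z) * deriv ξ z - 2 * ξ z)
      atTop (nhds 0) := by
    refine squeeze_zero_norm' (a := fun z => (2 * (A + B) + 2 * A) / Real.cosh z) ?_
      (hcosh.const_div_atTop _)
    filter_upwards [eventually_ge_atTop 1] with z hz
    have hz0 : 0 < z := by linarith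
    have hc := Real.cosh_pos z
    have hs := Real.sinh_pos_iff.2 hz0
    have hsc := Real.sinh_lt_cosh z
    have hw := ssw_pos hz0
    have h1 : |ξ z| * Real.cosh z ≤ A := by
      have := hVb z hz
      rwa [ssV, abs_mul, abs_of_pos hc] at this
    have h2 : |ssD ξ z| ≤ B := by
      rw [hB, le_div_iff₀ hw1]
      have := hMb z hz
      rw [ssM, abs_mul, abs_of_pos hw] at this
      have := mul_le_mul_of_nonneg_right (ssw_mono hz) (abs_nonneg (ssD ξ z))
      linarith
    have h3 : |deriv ξ z| * Real.cosh z ≤ A + B := by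
      have e : deriv ξ z * Real.cosh z = ssD ξ z - ξ z * Real.sinh z := by unfold ssD; ring
      have e2 : |deriv ξ z| * Real.cosh z = |ssD ξ z - ξ z * Real.sinh z| := by
        rw [← e, abs_mul, abs_of_pos hc]
      rw [e2]
      have := abs_sub (ssD ξ z) (ξ z * Real.sinh z)
      rw [abs_mul (ξ z), abs_of_pos hs] at this
      have := mul_le_mul_of_nonneg_left hsc.le (abs_nonneg (ξ z))
      linarith
    rw [Real.norm_eq_abs, le_div_iff₀ hc]
    have h4 := abs_sub (Real.sinh (2*z) * Real.log (Real.tanh z) * deriv ξ z) (2 * ξ z)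
    rw [abs_mul _ (deriv ξ z), abs_mul 2, abs_two] at h4
    have h5 := mul_le_mul_of_nonneg_right (ss_log_bound hz0) (abs_nonneg (deriv ξ z))
    have h6 := mul_le_mul_of_nonneg_right (h4.trans (by gcongr :
      _ ≤ 2 * |deriv ξ z| + 2 * |ξ z|)) hc.le
    linarith
  set W := fun z => Real.sinh (2*z) * Real.log (Real.tanh z) * deriv ξ z - 2 * ξ z with hW
  have hWd : ∀ z, 0 < z → HasDerivAt W
      (-lam * (Real.sinh (2*z) * Real.log (Real.tanh z) * ξ z)) z :=
    fun z hz => ss_dW hξ hode hz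
  have hWne : ∀ z ∈ Ioi (0:ℝ), -lam * (Real.sinh (2*z) * Real.log (Real.tanh z) * ξ z) ≠ 0 := by
    intro z hz
    have hz : 0 < z := hz
    have hs2 : 0 < Real.sinh (2*z) := Real.sinh_pos_iff.2 (by linarith)
    have hs := Real.sinh_pos_iff.2 hz
    have hc := Real.cosh_pos z
    have ht : 0 < Real.tanh z := by rw [Real.tanh_eq_sinh_div_cosh]; positivity
    have hl : Real.log (Real.tanh z) < 0 := Real.log_neg ht (Real.tanh_lt_one z)
    exact mul_ne_zero (neg_ne_zero.2 hlam0) (mul_ne_zero (mul_ne_zero hs2.ne' hl.ne) (hξne z hz))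
  have hcont : ContinuousOn W (Ioi 0) := fun z hz => (hWd z hz).continuousAt.continuousWithinAt
  rcases hasDerivWithinAt_forall_lt_or_forall_gt_of_forall_ne (convex_Ioi (0:ℝ))
    (fun z hz => (hWd z hz).hasDerivWithinAt) hWne with h | h
  · refine ss_not_strictMono (f := fun z => -W z) ?_ (by simpa using hrobin.neg)
      (by simpa using hWinf.neg)
    refine strictMonoOn_of_hasDerivWithinAt_pos (convex_Ioi 0) hcont.neg
      (fun z hz => ?_) (fun z hz => ?_) (f' := fun z =>
        -(-lam * (Real.sinh (2*z) * Real.log (Real.tanh z) * ξ z)))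
    · rw [interior_Ioi] at hz
      exact (hWd z hz).neg.hasDerivWithinAt
    · rw [interior_Ioi] at hz
      exact neg_pos.2 (h z hz)
  · refine ss_not_strictMono ?_ hrobin hWinf
    refine strictMonoOn_of_hasDerivWithinAt_pos (convex_Ioi 0) hcont
      (fun z hz => ?_) (fun z hz => ?_) (f' := fun z =>
        (-lam * (Real.sinh (2*z) * Real.log (Real.tanh z) * ξ z)))
    · rw [interior_Ioi] at hz
      exact (hWd z hz).hasDerivWithinAt
    · rw [interior_Ioi] at hz
      exact h z hz
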